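/- arXiv:quant-ph/0702129 — 4 statements merged into one kernel-verified Lean document; each statement's English description precedes it below -/
import Mathlib

section
/- Let G be a finite group of order N and Γ ⊆ G a nonempty subset closed under inverses. If v ∈ ℂ^G satisfies Mv = λv, then for every g ∈ G the matrix μ_{v,g} satisfies T(μ_{v,g}) = λ·μ_{v,g}. -/
open scoped Matrix

variable {G : Type*} [Group G] [Fintype G] [DecidableEq G]

/-- The permutation matrix `P_γ` with `P_γ|x⟩ = |xγ⟩`. -/
def rightPerm (γ : G) : Matrix G G ℂ :=
  Matrix.of fun a b => if a = b * γ then 1 else 0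

/-- The Cayley operator `M` of `C(G,Γ)`: `M|x⟩ = (1/|Γ|)·Σ_{γ∈Γ} |xγ⟩`. -/
noncomputable def cayleyM (Γ : Finset G) : Matrix G G ℂ :=
  (Γ.card : ℂ)⁻¹ • ∑ γ ∈ Γ, rightPerm γ

/-- The superoperator `T(A) = (1/|Γ|)·Σ_{γ∈Γ} P_γ A P_γ†`. -/
noncomputable def cayleyT (Γ : Finset G) (A : Matrix G G ℂ) : Matrix G G ℂ :=
  (Γ.card : ℂ)⁻¹ • ∑ γ ∈ Γ, rightPerm γ * A * (rightPerm γ)ᴴ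

/-- The matrix `μ_{v,g} = Σ_{x∈G} v(x)·|gx⟩⟨x|`. -/
def muMat (v : G → ℂ) (g : G) : Matrix G G ℂ :=
  Matrix.of fun a b => if a = g * b then v b else 0

theorem rightPerm_apply {H : Type*} [Group H] [DecidableEq H] (γ a b : H) :
    rightPerm γ a b = if b = a * γ⁻¹ then 1 else 0 := by
  simp only [rightPerm, Matrix.of_apply, eq_mul_inv_iff_mul_eq, eq_comm]

theorem rightPerm_mulVec (γ : G) (v : G → ℂ) (a : G) :
    (rightPerm γ).mulVec v a = v (a * γ⁻¹) := by
  simp [Matrix.mulVec, dotProduct, rightPerm_apply]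

theorem rightPerm_mul_apply (γ : G) (A : Matrix G G ℂ) (a b : G) :
    (rightPerm γ * A) a b = A (a * γ⁻¹) b := by
  simp [Matrix.mul_apply, rightPerm_apply]

theorem mul_conjTranspose_rightPerm_apply (γ : G) (A : Matrix G G ℂ) (a b : G) :
    (A * (rightPerm γ)ᴴ) a b = A a (b * γ⁻¹) := by
  simp [Matrix.mul_apply, rightPerm_apply, apply_ite]

/-- Conjugating `μ_{v,g}` by `P_γ` yields `μ_{P_γ v,g}`. -/
theorem rightPerm_conj_muMat (γ : G) (v : G → ℂ) (g : G) :
    rightPerm γ * muMat v g * (rightPerm γ)ᴴ = muMat ((rightPerm γ).mulVec v) g := by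
  ext a b
  rw [mul_conjTranspose_rightPerm_apply, rightPerm_mul_apply]
  simp [muMat, rightPerm_mulVec, ← mul_assoc]

/-- The superoperator acts on `μ_{v,g}` through the Cayley operator on `v`. -/
theorem cayleyT_muMat (Γ : Finset G) (v : G → ℂ) (g : G) :
    cayleyT Γ (muMat v g) = muMat ((cayleyM Γ).mulVec v) g := by
  ext a b
  simp only [cayleyT, cayleyM, rightPerm_conj_muMat]
  by_cases h : a = g * b <;>
    simp [muMat, h, Matrix.sum_apply, Matrix.smul_mulVec, Matrix.sum_mulVec]

theorem muMat_smul {H : Type*} [Group H] [DecidableEq H] (c : ℂ) (v : H → ℂ) (g : H) :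
    muMat (c • v) g = c • muMat v g := by
  ext a b
  simp [muMat]

/-- Let `G` be a finite group of order `N` and `Γ ⊆ G` a nonempty subset
closed under inverses. If `v ∈ ℂ^G` satisfies `Mv = λv`, then for every `g ∈ G` the matrix
`μ_{v,g}` satisfies `T(μ_{v,g}) = λ·μ_{v,g}`. -/
theorem cayleyT_muMat_eq_smul (Γ : Finset G) (hne : Γ.Nonempty)
    (hinv : ∀ γ ∈ Γ, γ⁻¹ ∈ Γ)
    (v : G → ℂ) (lam : ℂ) (hv : (cayleyM Γ).mulVec v = lam • v) (g : G) :
    cayleyT Γ (muMat v g) = lam • muMat v g := by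
  rw [cayleyT_muMat, hv, muMat_smul]
end

section
/- Let G be a finite abelian group of order N with identity e, equipped with a character pairing χ as in the context, and let U be the unitary N×N matrix (the Fourier transform over G) defined by U|g⟩ = (1/√N)·Σ_{x∈G} χ_g(x)|x⟩. For g, i ∈ G define μ_{g,i} = (1/√N)·Σ_{x∈G} χ_g(x)·|ix⟩⟨x|. Then U μ_{g,i} U† = χ_i(g⁻¹)·μ_{i,g⁻¹}. -/
open scoped Matrix

variable {G : Type*} [CommGroup G] [Fintype G] [DecidableEq G]

/-- The Fourier transform matrix `U` over an abelian group `G`, determined by a character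
pairing `χ`: `U|g⟩ = (1/√N)·Σ_{x∈G} χ_g(x)|x⟩`. -/
noncomputable def fourierU (χ : G → G → ℂ) : Matrix G G ℂ :=
  Matrix.of fun a b => ((Real.sqrt (Fintype.card G) : ℂ))⁻¹ * χ b a

/-- The matrix `μ_{g,i} = (1/√N)·Σ_{x∈G} χ_g(x)·|ix⟩⟨x|`. -/
noncomputable def muChi (χ : G → G → ℂ) (g i : G) : Matrix G G ℂ :=
  Matrix.of fun a b =>
    if a = i * b then ((Real.sqrt (Fintype.card G) : ℂ))⁻¹ * χ g b else 0

/-- Let `G` be a finite abelian group of order `N` with a character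
pairing `χ`, and let `U` be the Fourier transform over `G`.  Then
`U μ_{g,i} U† = χ_i(g⁻¹)·μ_{i,g⁻¹}`. -/
theorem fourierU_muChi_conj (χ : G → G → ℂ)
    (hmul : ∀ g x y : G, χ g (x * y) = χ g x * χ g y)
    (hsym : ∀ g x : G, χ g x = χ x g)
    (hconj : ∀ g x : G, (starRingEnd ℂ) (χ g x) = χ g x⁻¹)
    (horth : ∀ g h : G,
      (Fintype.card G : ℂ)⁻¹ * ∑ x, χ g x * (starRingEnd ℂ) (χ h x) =
        if g = h then 1 else 0)
    (g i : G) :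
    fourierU χ * muChi χ g i * (fourierU χ)ᴴ = χ i g⁻¹ • muChi χ i g⁻¹ := by
  ext a b
  have h_row : ∀ x : G, (fourierU χ * muChi χ g i) a x =
      (Real.sqrt (Fintype.card G) : ℂ)⁻¹ * χ (i * x) a *
        ((Real.sqrt (Fintype.card G) : ℂ)⁻¹ * χ g x) := fun x => by
    simp [Matrix.mul_apply, fourierU, muChi]
  have h_sq : (Real.sqrt (Fintype.card G) : ℂ)⁻¹ * (Real.sqrt (Fintype.card G) : ℂ)⁻¹ =
      (Fintype.card G : ℂ)⁻¹ := by
    rw [← mul_inv, ← Complex.ofReal_mul, Real.mul_self_sqrt (Nat.cast_nonneg _),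
      Complex.ofReal_natCast]
  have h_term : ∀ x : G, (fourierU χ * muChi χ g i) a x * (fourierU χ)ᴴ x b =
      (Real.sqrt (Fintype.card G) : ℂ)⁻¹ * χ i a *
        ((Fintype.card G : ℂ)⁻¹ * (χ (a * g) x * (starRingEnd ℂ) (χ b x))) := fun x => by
    have h_conjTranspose : (fourierU χ)ᴴ x b =
        (Real.sqrt (Fintype.card G) : ℂ)⁻¹ * (starRingEnd ℂ) (χ b x) := by
      simp [fourierU, Matrix.conjTranspose_apply, hsym x b]
    rw [h_row, h_conjTranspose, ← h_sq, hsym (i * x) a, hmul a i x, hsym (a * g) x, hmul x a g,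
      hsym a i, hsym x a, hsym x g]
    ring
  rw [Matrix.mul_apply, Finset.sum_congr rfl fun x _ => h_term x, ← Finset.mul_sum,
    ← Finset.mul_sum, horth, Matrix.smul_apply, muChi, Matrix.of_apply, smul_eq_mul]
  by_cases h : a = g⁻¹ * b
  · have h' : a * g = b := by rw [h, mul_right_comm, inv_mul_cancel, one_mul]
    rw [if_pos h, if_pos h', h, hmul]
    ring
  · have h' : a * g ≠ b := fun hb => h (by rw [← hb, mul_comm a g, inv_mul_cancel_left])
    rw [if_neg h, if_neg h', mul_zero, mul_zero]
end

section
/- Let G be a finite group of order N with identity e, and let (d_k, ρ^k)_{k∈K} be a complete orthogonal family of matrix representations of G as in the context. Let f be a bijection from {(k,i,j) : k ∈ K, 1 ≤ i,j ≤ d_k} to G which is product, i.e. for each k there exist functions f₁, f₂ : {1,…,d_k} → G with f(k,i,j) = f₁(i)·f₂(j) for all i,j. Define the linear map U on ℂ^G by U|g⟩ = Σ_{k∈K} Σ_{1≤i,j≤d_k} √(d_k/N)·ρ^k_{i,j}(g)·ω_{d_k}^{ij}·|f(k,i,j)⟩, where ω_{d_k} = e^{2πi/d_k}. Then U is unitary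 and for every g₁ ∈ G with g₁ ≠ e and every g₂ ∈ G, Tr(U·ρ_reg(g₁)·U†·ρ_reg(g₂)) = 0 (i.e., U is a good basis change for G). -/
open scoped Matrix

variable {G : Type*} [Group G] [Fintype G] [DecidableEq G]

/-- The left-regular-representation permutation matrix `ρ_reg(g) = Σ_{x∈G} |gx⟩⟨x|`. -/
def regRep (g : G) : Matrix G G ℂ :=
  Matrix.of fun a b => if a = g * b then 1 else 0

/-- The phase `ω_d ^ (ij)`, with `ω_d = exp (2πi / d)` and `i`, `j` counted from `1`. -/
noncomputable def fourierPhase (d : ℕ) (i j : Fin d) : ℂ :=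
  Complex.exp (2 * Real.pi * Complex.I * (((i : ℕ) + 1) * ((j : ℕ) + 1)) / (d : ℂ))

theorem fourierPhase_eq_pow (d : ℕ) (i j : Fin d) :
    fourierPhase d i j =
      (Complex.exp (2 * Real.pi * Complex.I / d) ^ ((i : ℕ) + 1)) ^ ((j : ℕ) + 1) := by
  rw [fourierPhase, ← pow_mul, ← Complex.exp_nat_mul]
  congr 1
  push_cast
  ring

theorem conj_exp_two_pi_I_div (d : ℕ) :
    (starRingEnd ℂ) (Complex.exp (2 * Real.pi * Complex.I / d)) =
      (Complex.exp (2 * Real.pi * Complex.I / d))⁻¹ := by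
  rw [← Complex.exp_conj, ← Complex.exp_neg]
  congr 1
  simp [map_div₀, neg_div, Complex.conj_ofNat]

theorem fourierPhase_mul_conj (d : ℕ) (i l j : Fin d) :
    fourierPhase d i j * (starRingEnd ℂ) (fourierPhase d l j) =
      (Complex.exp (2 * Real.pi * Complex.I / d) ^ ((i : ℕ) + 1) *
        (Complex.exp (2 * Real.pi * Complex.I / d) ^ ((l : ℕ) + 1))⁻¹) ^ ((j : ℕ) + 1) := by
  rw [fourierPhase_eq_pow, fourierPhase_eq_pow, map_pow, map_pow, conj_exp_two_pi_I_div,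
    mul_pow, inv_pow]

theorem fourierPhase_mul_conj_self (d : ℕ) (i j : Fin d) :
    fourierPhase d i j * (starRingEnd ℂ) (fourierPhase d i j) = 1 := by
  rw [fourierPhase_mul_conj, mul_inv_cancel₀ (pow_ne_zero _ (Complex.exp_ne_zero _)), one_pow]

/-- Distinct rows of the Fourier matrix are orthogonal. -/
theorem sum_fourierPhase_mul_conj {d : ℕ} {i l : Fin d} (h : i ≠ l) :
    ∑ j, fourierPhase d i j * (starRingEnd ℂ) (fourierPhase d l j) = 0 := by
  have hd : d ≠ 0 := (i.pos).ne'
  have hω := Complex.isPrimitiveRoot_exp d hd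
  simp_rw [fourierPhase_mul_conj]
  generalize Complex.exp (2 * Real.pi * Complex.I / d) = ω at hω ⊢
  have hω0 : ω ≠ 0 := hω.ne_zero hd
  have hζ : ω ^ ((i : ℕ) + 1) * (ω ^ ((l : ℕ) + 1))⁻¹ ≠ 1 := by
    intro H
    rw [mul_inv_eq_one₀ (pow_ne_zero _ hω0), pow_succ, pow_succ] at H
    exact h (Fin.ext (hω.pow_inj i.2 l.2 (mul_right_cancel₀ hω0 H)))
  have hζd : (ω ^ ((i : ℕ) + 1) * (ω ^ ((l : ℕ) + 1))⁻¹) ^ d = 1 := by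
    rw [mul_pow, inv_pow, ← pow_mul, ← pow_mul, mul_comm _ d, mul_comm _ d, pow_mul, pow_mul,
      hω.pow_eq_one]
    simp
  generalize ω ^ ((i : ℕ) + 1) * (ω ^ ((l : ℕ) + 1))⁻¹ = ζ at hζ hζd
  simp_rw [pow_succ]
  rw [← Finset.sum_mul, Fin.sum_univ_eq_sum_range (fun n => ζ ^ n), geom_sum_eq hζ, hζd]
  simp

theorem mul_regRep_apply (M : Matrix G G ℂ) (g a b : G) :
    (M * regRep g) a b = M a (g * b) := by
  simp [Matrix.mul_apply, regRep]

theorem trace_regRep_of_ne_one {g : G} (hg : g ≠ 1) : (regRep g).trace = 0 := by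
  simp [Matrix.trace, regRep, hg]

theorem trace_conj_regRep (U : Matrix G G ℂ) (g₁ g₂ : G) :
    (U * regRep g₁ * Uᴴ * regRep g₂).trace =
      ∑ a, ∑ y, U a (g₁ * y) * (starRingEnd ℂ) (U (g₂ * a) y) := by
  simp only [Matrix.trace, Matrix.diag_apply, mul_regRep_apply, Matrix.mul_apply (N := Uᴴ),
    Matrix.conjTranspose_apply, starRingEnd_apply]


/-- Let `G` be a finite group of order `N` with identity `e`, and let
`(d_k, ρ^k)_{k∈K}` be a complete orthogonal family of matrix representations of `G`.
Let `f` be a product bijection from `{(k,i,j)}` to `G`.  Define `U` on `ℂ^G` by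
`U|g⟩ = Σ_{k,i,j} √(d_k/N)·ρ^k_{i,j}(g)·ω_{d_k}^{ij}·|f(k,i,j)⟩` where
`ω_{d_k} = e^{2πi/d_k}` (indices `i,j` running over `1,…,d_k`).  Then `U` is unitary
and is a good basis change: `Tr(U·ρ_reg(g₁)·U†·ρ_reg(g₂)) = 0` for all `g₁ ≠ e`, `g₂`. -/
theorem product_bijection_good_basis_change
    {K : Type*} [Fintype K] [DecidableEq K] (d : K → ℕ) (hd : ∀ k, 0 < d k)
    (hcomplete : ∑ k, (d k) ^ 2 = Fintype.card G)
    (rep : (k : K) → G → Matrix (Fin (d k)) (Fin (d k)) ℂ)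
    (hmul : ∀ k (g h : G), rep k (g * h) = rep k g * rep k h)
    (hschur : ∀ p q : Σ k : K, Fin (d k) × Fin (d k),
      ((Real.sqrt ((d p.1) * (d q.1)) : ℂ) / (Fintype.card G : ℂ)) *
        ∑ x, rep p.1 x p.2.1 p.2.2 * (starRingEnd ℂ) (rep q.1 x q.2.1 q.2.2) =
      if p = q then 1 else 0)
    (f : (Σ k : K, Fin (d k) × Fin (d k)) → G) (hf : Function.Bijective f)
    (hprod : ∀ k : K, ∃ f₁ f₂ : Fin (d k) → G,
      ∀ i j : Fin (d k), f ⟨k, (i, j)⟩ = f₁ i * f₂ j)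
    (U : Matrix G G ℂ)
    (hU : ∀ (a g : G), U a g =
      ∑ p : Σ k : K, Fin (d k) × Fin (d k),
        if f p = a then
          (Real.sqrt ((d p.1 : ℝ) / (Fintype.card G : ℝ)) : ℂ) *
            rep p.1 g p.2.1 p.2.2 *
            Complex.exp (2 * Real.pi * Complex.I *
              (((p.2.1 : ℕ) + 1) * ((p.2.2 : ℕ) + 1)) / (d p.1 : ℂ))
        else 0) :
    Uᴴ * U = 1 ∧
    ∀ g₁ : G, g₁ ≠ 1 → ∀ g₂ : G,
      (U * regRep g₁ * Uᴴ * regRep g₂).trace = 0 := by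
  have hV (p : Σ k : K, Fin (d k) × Fin (d k)) (g : G) : U (f p) g =
      (Real.sqrt ((d p.1 : ℝ) / (Fintype.card G : ℝ)) : ℂ) * rep p.1 g p.2.1 p.2.2 *
        fourierPhase (d p.1) p.2.1 p.2.2 := by
    simp [hU, hf.1.eq_iff, fourierPhase]
  have horth (p q : Σ k : K, Fin (d k) × Fin (d k)) :
      (Real.sqrt ((d p.1 : ℝ) / (Fintype.card G : ℝ)) : ℂ) *
        (Real.sqrt ((d q.1 : ℝ) / (Fintype.card G : ℝ)) : ℂ) *
        ∑ x, rep p.1 x p.2.1 p.2.2 * (starRingEnd ℂ) (rep q.1 x q.2.1 q.2.2) =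
      if p = q then 1 else 0 := by
    rw [← hschur p q, ← Complex.ofReal_mul, ← Complex.ofReal_natCast (Fintype.card G),
      ← Complex.ofReal_div]
    congr 2
    rw [Real.sqrt_div (Nat.cast_nonneg _), Real.sqrt_div (Nat.cast_nonneg _), div_mul_div_comm,
      Real.mul_self_sqrt (Nat.cast_nonneg _), Real.sqrt_mul (Nat.cast_nonneg _)]
  have hinner (p q : Σ k : K, Fin (d k) × Fin (d k)) (g : G) :
      ∑ y, U (f p) (g * y) * (starRingEnd ℂ) (U (f q) y) =
        ∑ l, if (⟨p.1, (l, p.2.2)⟩ : Σ k : K, Fin (d k) × Fin (d k)) = q then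
          rep p.1 g p.2.1 l * (fourierPhase (d p.1) p.2.1 p.2.2 *
            (starRingEnd ℂ) (fourierPhase (d q.1) q.2.1 q.2.2)) else 0 := by
    have key (l : Fin (d p.1)) := horth ⟨p.1, (l, p.2.2)⟩ q
    calc _ = ∑ l, (rep p.1 g p.2.1 l * (fourierPhase (d p.1) p.2.1 p.2.2 *
            (starRingEnd ℂ) (fourierPhase (d q.1) q.2.1 q.2.2))) *
            (if (⟨p.1, (l, p.2.2)⟩ : Σ k : K, Fin (d k) × Fin (d k)) = q then 1 else 0) := by
          simp_rw [← key, hV, hmul, Matrix.mul_apply, map_mul, Complex.conj_ofReal,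
            Finset.mul_sum, Finset.sum_mul]
          rw [Finset.sum_comm]
          refine Finset.sum_congr rfl fun l _ => Finset.sum_congr rfl fun y _ => ?_
          ring
      _ = _ := by simp
  have hunitary : Uᴴ * U = 1 := by
    rw [mul_eq_one_comm]
    ext a b
    obtain ⟨p, rfl⟩ := hf.2 a
    obtain ⟨q, rfl⟩ := hf.2 b
    have h : ∑ y, U (f p) y * (starRingEnd ℂ) (U (f q) y) = if p = q then 1 else 0 := by
      calc _ = (fourierPhase (d p.1) p.2.1 p.2.2 *
            (starRingEnd ℂ) (fourierPhase (d q.1) q.2.1 q.2.2)) *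
            (if p = q then 1 else 0) := by
            simp_rw [← horth, hV, map_mul, Complex.conj_ofReal, Finset.mul_sum]
            refine Finset.sum_congr rfl fun y _ => ?_
            ring
        _ = _ := by
            split_ifs with hpq
            · subst hpq
              rw [fourierPhase_mul_conj_self, one_mul]
            · rw [mul_zero]
    simpa [Matrix.mul_apply, Matrix.one_apply, hf.1.eq_iff] using h
  refine ⟨hunitary, fun g₁ hg₁ g₂ => ?_⟩
  by_cases hg₂ : g₂ = 1
  · have h1 : regRep (1 : G) = 1 := by
      ext a b
      simp [regRep, Matrix.one_apply]
    rw [hg₂, h1, mul_one, Matrix.trace_mul_comm, ← mul_assoc, hunitary, one_mul,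
      trace_regRep_of_ne_one hg₁]
  rw [trace_conj_regRep, ← hf.sum_comp]
  have hrow (k : K) (i j : Fin (d k)) :
      ∑ y, U (f ⟨k, (i, j)⟩) (g₁ * y) * (starRingEnd ℂ) (U (g₂ * f ⟨k, (i, j)⟩) y) =
        ∑ l, if f ⟨k, (l, j)⟩ = g₂ * f ⟨k, (i, j)⟩ then
          rep k g₁ i l * (fourierPhase (d k) i j *
            (starRingEnd ℂ) (fourierPhase (d k) l j)) else 0 := by
    obtain ⟨q, hq⟩ := hf.2 (g₂ * f ⟨k, (i, j)⟩)
    rw [← hq, hinner]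
    refine Finset.sum_congr rfl fun l _ => ?_
    simp only [hf.1.eq_iff]
    split_ifs with h
    · subst h
      rfl
    · rfl
  simp_rw [Fintype.sum_sigma, Fintype.sum_prod_type, hrow]
  refine Finset.sum_eq_zero fun k _ => Finset.sum_eq_zero fun i _ => ?_
  rw [Finset.sum_comm]
  refine Finset.sum_eq_zero fun l _ => ?_
  obtain ⟨f₁, f₂, hk⟩ := hprod k
  simp_rw [hk, ← mul_assoc g₂, mul_left_inj]
  split_ifs with h
  · have hil : i ≠ l := by
      rintro rfl
      exact hg₂ (by simpa using h)
    rw [← Finset.mul_sum, sum_fourierPhase_mul_conj hil, mul_zero]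
  · simp
end

section
/- Let n be a positive integer, let ε > 0, and let λ : {1,…,2^n} → [0,1] with Σ_i λ_i = 1 (the eigenvalue distribution of an n-qubit density matrix). If the Shannon entropy Σ_{i : λ_i>0} λ_i·log₂(1/λ_i) is at most (1−ε)·n, then (1/2)·Σ_{i=1}^{2^n} |λ_i − 2^{-n}| ≥ ε − 2^{-n}. -/
/-- A lower bound for `negMulLog` on `[c, 1]`, from concavity on the chord from `c` to `1`. -/
theorem Real.one_sub_mul_negMulLog_le {c x : ℝ} (hc : 0 < c) (hc1 : c < 1) (hcx : c ≤ x)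
    (hx1 : x ≤ 1) : (1 - x) * Real.negMulLog c ≤ Real.negMulLog x := by
  have hc' : 0 < 1 - c := by linarith
  have hconc := Real.concaveOn_negMulLog.2 (Set.mem_Ici.2 hc.le) (Set.mem_Ici.2 zero_le_one)
    (div_nonneg (sub_nonneg.2 hx1) hc'.le) (div_nonneg (sub_nonneg.2 hcx) hc'.le)
    (by field_simp; ring)
  have hx : (1 - x) / (1 - c) * c + (x - c) / (1 - c) * 1 = x := by field_simp; ring
  simp only [smul_eq_mul, hx, Real.negMulLog_one, mul_zero, add_zero] at hconc
  refine le_trans (mul_le_mul_of_nonneg_right ?_ (Real.negMulLog_nonneg hc.le hc1.le)) hconc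
  exact le_div_self (by linarith) hc' (by linarith)

/-- An entropy summand is at least `-log c` times the truncation `min x c`, up to an error
proportional to `x`. -/
theorem Real.min_sub_mul_neg_log_le_negMulLog {c x : ℝ} (hc : 0 < c) (hc1 : c < 1) (hx : 0 ≤ x)
    (hx1 : x ≤ 1) : (min x c - c * x) * (-Real.log c) ≤ Real.negMulLog x := by
  have hlog : 0 ≤ -Real.log c := neg_nonneg.2 (Real.log_nonpos hc.le hc1.le)
  rcases le_total x c with h | h
  · rw [min_eq_left h]
    rcases hx.eq_or_lt with rfl | hpos
    · simp
    · have hle : x * Real.log x ≤ x * Real.log c :=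
        mul_le_mul_of_nonneg_left (Real.log_le_log hpos h) hx
      have herr : 0 ≤ c * x * (-Real.log c) := by positivity
      rw [Real.negMulLog]
      linarith
  · rw [min_eq_right h]
    have hchord := Real.one_sub_mul_negMulLog_le hc hc1 h hx1
    rw [Real.negMulLog] at hchord
    linarith


/-- Let `n` be a positive integer, `ε > 0`, and `λ : {1,…,2^n} → [0,1]`
with `Σ_i λ_i = 1`.  If the Shannon entropy `Σ_{i : λ_i>0} λ_i·log₂(1/λ_i)` is at most
`(1−ε)·n`, then `(1/2)·Σ_i |λ_i − 2^{-n}| ≥ ε − 2^{-n}`. -/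
theorem low_entropy_far_from_uniform (n : ℕ) (hn : 0 < n) (ε : ℝ) (hε : 0 < ε)
    (lam : Fin (2 ^ n) → ℝ) (h0 : ∀ i, 0 ≤ lam i) (h1 : ∀ i, lam i ≤ 1)
    (hsum : ∑ i, lam i = 1)
    (hent : ∑ i, lam i * Real.logb 2 (lam i)⁻¹ ≤ (1 - ε) * n) :
    ε - ((2 : ℝ) ^ n)⁻¹ ≤ (1 / 2) * ∑ i, |lam i - ((2 : ℝ) ^ n)⁻¹| := by
  set c : ℝ := ((2 : ℝ) ^ n)⁻¹ with hc_def
  have hc : 0 < c := by positivity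
  have hc1 : c < 1 := inv_lt_one_of_one_lt₀ (one_lt_pow₀ one_lt_two hn.ne')
  have hlog2 : 0 < Real.log 2 := Real.log_pos one_lt_two
  have hlogc : -Real.log c = n * Real.log 2 := by
    rw [hc_def, Real.log_inv, Real.log_pow, neg_neg]
  have hpoint : ∀ i, (min (lam i) c - c * lam i) * n ≤ lam i * Real.logb 2 (lam i)⁻¹ := by
    intro i
    have h := Real.min_sub_mul_neg_log_le_negMulLog hc hc1 (h0 i) (h1 i)
    rw [hlogc, Real.negMulLog] at h
    rw [Real.logb, Real.log_inv, ← mul_div_assoc, le_div_iff₀ hlog2]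
    linarith
  have hle := (Finset.sum_le_sum fun i (_ : i ∈ Finset.univ) => hpoint i).trans hent
  rw [← Finset.sum_mul, Finset.sum_sub_distrib, ← Finset.mul_sum, hsum] at hle
  have hle' := le_of_mul_le_mul_right hle (Nat.cast_pos.2 hn)
  have hcsum : ∑ _i : Fin (2 ^ n), c = 1 := by simp [hc_def]
  have hmin : ∑ i, min (lam i) c = 1 - (1 / 2) * ∑ i, |lam i - c| := by
    calc ∑ i, min (lam i) c = ∑ i, (1 / 2) * (lam i + c - |lam i - c|) := by
          refine Finset.sum_congr rfl fun i _ => ?_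
          rcases le_total (lam i) c with h | h
          · rw [min_eq_left h, abs_of_nonpos (sub_nonpos.2 h)]
            ring
          · rw [min_eq_right h, abs_of_nonneg (sub_nonneg.2 h)]
            ring
      _ = 1 - (1 / 2) * ∑ i, |lam i - c| := by
          rw [← Finset.mul_sum, Finset.sum_sub_distrib, Finset.sum_add_distrib, hsum, hcsum]
          ring
  linarith
end
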